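/- arXiv:0804.1267 — 2 statements merged into one kernel-verified Lean document; each statement's English description precedes it below -/
import Mathlib

section
/- Let E, F, G be finite-dimensional real normed vector spaces and k a natural number. Let f, g : F → G be maps that are C^k on a neighborhood of a point z ∈ F, with f(z) = g(z) and with equal iterated Fréchet derivatives iteratedFDeriv ℝ i f z = iteratedFDeriv ℝ i g z for every i ≤ k. Let φ : E → F be a map that is C^k on a neighborhood of a point y ∈ E with φ(y) = z. Then iteratedFDeriv ℝ i (f ∘ φ) y = iteratedFDeriv ℝ i (g ∘ φ) y for every i ≤ k. -/
/-- If two maps `f, g : F → G` are `C^k` near `z`, take the same value at `z` and have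
the same iterated Fréchet derivatives at `z` up to order `k`, then for any map
`φ : E → F` which is `C^k` near `y` with `φ y = z`, the compositions `f ∘ φ` and
`g ∘ φ` have the same iterated derivatives at `y` up to order `k`. -/
theorem iteratedFDeriv_comp_congr_left
    {E F G : Type*}
    [NormedAddCommGroup E] [NormedSpace ℝ E] [FiniteDimensional ℝ E]
    [NormedAddCommGroup F] [NormedSpace ℝ F] [FiniteDimensional ℝ F]
    [NormedAddCommGroup G] [NormedSpace ℝ G] [FiniteDimensional ℝ G]
    (k : ℕ) (f g : F → G) (z : F)
    (hf : ContDiffAt ℝ k f z) (hg : ContDiffAt ℝ k g z)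
    (hval : f z = g z)
    (hder : ∀ i ≤ k, iteratedFDeriv ℝ i f z = iteratedFDeriv ℝ i g z)
    (φ : E → F) (y : E) (hφ : ContDiffAt ℝ k φ y) (hφy : φ y = z) :
    ∀ i ≤ k, iteratedFDeriv ℝ i (f ∘ φ) y = iteratedFDeriv ℝ i (g ∘ φ) y := by
  subst hφy
  intro i hi
  have hi' : ((i : ℕ) : WithTop ℕ∞) ≤ (k : WithTop ℕ∞) := by exact_mod_cast hi
  rw [iteratedFDeriv_comp hf hφ hi', iteratedFDeriv_comp hg hφ hi']
  unfold FormalMultilinearSeries.taylorComp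
  refine Finset.sum_congr rfl fun c _ => ?_
  unfold FormalMultilinearSeries.compAlongOrderedFinpartition
  have h : ftaylorSeries ℝ f (φ y) c.length = ftaylorSeries ℝ g (φ y) c.length :=
    hder _ (c.length_le.trans hi)
  rw [h]
end

section
/- Let F, G, H be finite-dimensional real normed vector spaces and k a natural number. Let f, g : F → G be maps that are C^k on a neighborhood of a point z ∈ F, with f(z) = g(z) and with equal iterated Fréchet derivatives iteratedFDeriv ℝ i f z = iteratedFDeriv ℝ i g z for every i ≤ k. Let ψ : G → H be a map that is C^k on a neighborhood of f(z). Then iteratedFDeriv ℝ i (ψ ∘ f) z = iteratedFDeriv ℝ i (ψ ∘ g) z for every i ≤ k. -/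
/-- If two maps `f, g : F → G` are `C^k` near `z`, take the same value at `z` and have
the same iterated Fréchet derivatives at `z` up to order `k`, then for any map
`ψ : G → H` which is `C^k` near `f z`, the compositions `ψ ∘ f` and `ψ ∘ g` have the
same iterated derivatives at `z` up to order `k`. -/
theorem iteratedFDeriv_comp_congr_right
    {F G H : Type*}
    [NormedAddCommGroup F] [NormedSpace ℝ F] [FiniteDimensional ℝ F]
    [NormedAddCommGroup G] [NormedSpace ℝ G] [FiniteDimensional ℝ G]
    [NormedAddCommGroup H] [NormedSpace ℝ H] [FiniteDimensional ℝ H]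
    (k : ℕ) (f g : F → G) (z : F)
    (hf : ContDiffAt ℝ k f z) (hg : ContDiffAt ℝ k g z)
    (hval : f z = g z)
    (hder : ∀ i ≤ k, iteratedFDeriv ℝ i f z = iteratedFDeriv ℝ i g z)
    (ψ : G → H) (hψ : ContDiffAt ℝ k ψ (f z)) :
    ∀ i ≤ k, iteratedFDeriv ℝ i (ψ ∘ f) z = iteratedFDeriv ℝ i (ψ ∘ g) z := by
  intro i hi
  have hik : (i : WithTop ℕ∞) ≤ (k : WithTop ℕ∞) := by exact_mod_cast hi
  have hψ' : ContDiffAt ℝ k ψ (g z) := hval ▸ hψ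
  rw [iteratedFDeriv_comp hψ hf hik, iteratedFDeriv_comp hψ' hg hik, ← hval]
  unfold FormalMultilinearSeries.taylorComp
  refine Finset.sum_congr rfl fun c _ => ?_
  ext v
  simp only [FormalMultilinearSeries.compAlongOrderedFinpartition_apply]
  congr 1
  funext m
  simp only [OrderedFinpartition.applyOrderedFinpartition, ftaylorSeries]
  rw [hder _ ((c.partSize_le m).trans hi)]
end
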